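/- If a pure-form CMI K = (C, ⟨Q_1,…,Q_k⟩) with k ≥ 2 is valid for a given joint distribution of X_1,…,X_n, then H(X_q | X_C) = 0 for every repeated index q of K (i.e., every q belonging to Q_{i} ∩ Q_{j} for some i ≠ j). -/

import Mathlib

open scoped Classical

namespace Paper

variable {n : ℕ}

/-- The marginal distribution of the coordinates in `α` of a joint distribution `p` of
the discrete random variables `X_1, …, X_n` (each taking countably many values, coded
as natural numbers). -/
noncomputable def marginal (p : PMF (Fin n → ℕ)) (α : Finset (Fin n)) :
    PMF ({ i // i ∈ α } → ℕ) :=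
  p.map fun x i => x i.1

/-- The Shannon (joint) entropy `H(X_α)`. -/
noncomputable def Hm (p : PMF (Fin n → ℕ)) (α : Finset (Fin n)) : ℝ :=
  ∑' y, Real.negMulLog ((marginal p α) y).toReal

/-- The conditional entropy `H(X_β | X_α) = H(X_{β ∪ α}) - H(X_α)`. -/
noncomputable def Hc (p : PMF (Fin n → ℕ)) (β α : Finset (Fin n)) : ℝ :=
  Hm p (β ∪ α) - Hm p α

/-- Every individual random variable `X_i` has finite Shannon entropy
(the series defining `H(X_i)` is summable). -/
def FiniteEntropy (p : PMF (Fin n → ℕ)) : Prop :=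
  ∀ i : Fin n, Summable fun y : ℕ => Real.negMulLog ((p.map fun x => x i) y).toReal

/-- `J(X_{Q_1}, …, X_{Q_k} | X_C) = (∑ i, H(X_{Q_i}|X_C)) - H(X_{Q_1},…,X_{Q_k}|X_C)`;
the joint conditional entropy of the tuple `(X_{Q_1},…,X_{Q_k})` equals
`H(X_{∪ i, Q_i} | X_C)` since the two tuples determine each other. -/
noncomputable def J (p : PMF (Fin n → ℕ)) (C : Finset (Fin n))
    (Qs : Multiset (Finset (Fin n))) : ℝ :=
  (Qs.map fun Q => Hc p Q C).sum - Hc p Qs.sup C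

/-- A conditional mutual independency (CMI) on `{1, …, n}`: a conditioning set `C`
together with a finite multiset `⟨Q_1, …, Q_k⟩` of subsets of `{1, …, n}`. -/
structure CMI (n : ℕ) where
  C : Finset (Fin n)
  Qs : Multiset (Finset (Fin n))

/-- `K` is valid for the joint distribution `p`. -/
def Valid (p : PMF (Fin n → ℕ)) (K : CMI n) : Prop :=
  J p K.C K.Qs = 0

/-- `K` is degenerate: valid for every finite-entropy joint distribution. -/
def Degenerate (K : CMI n) : Prop :=
  ∀ p : PMF (Fin n → ℕ), FiniteEntropy p → Valid p K

/-- `K ∼ K'`: valid for exactly the same finite-entropy joint distributions. -/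
def Equivalent (K K' : CMI n) : Prop :=
  ∀ p : PMF (Fin n → ℕ), FiniteEntropy p → (Valid p K ↔ Valid p K')

/-- `K` implies `K'`. -/
def Implies (K K' : CMI n) : Prop :=
  ∀ p : PMF (Fin n → ℕ), FiniteEntropy p → Valid p K → Valid p K'

/-- `K` is in pure form: every `Q_i` is nonempty and disjoint from `C`. -/
def IsPure (K : CMI n) : Prop :=
  ∀ Q ∈ K.Qs, Q ≠ ∅ ∧ Q ∩ K.C = ∅

/-- The pure form `pur(K) = (C, ⟨Q_i \ C : Q_i \ C ≠ ∅⟩)`. -/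
noncomputable def pur (K : CMI n) : CMI n :=
  ⟨K.C, (K.Qs.map fun Q => Q \ K.C).filter fun Q => Q ≠ ∅⟩

/-- The set `𝕀_K` of repeated indices of `K`: indices lying in `Q_i ∩ Q_j` for two
distinct entries `i ≠ j` of the multiset (automatically `∅` when `k ≤ 1`). -/
noncomputable def repSet (K : CMI n) : Finset (Fin n) :=
  Finset.univ.filter fun q => 2 ≤ Multiset.card (K.Qs.filter fun Q => q ∈ Q)

/-- The multiset `⟨P_1, …, P_t⟩` of nonempty sets among the `Q_i \ 𝕀_K`. -/
noncomputable def parts (K : CMI n) : Multiset (Finset (Fin n)) :=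
  (K.Qs.map fun Q => Q \ repSet K).filter fun P => P ≠ ∅

/-- The multiset of the `P_j`-entries of the canonical form `can(K)`
(general notation). -/
noncomputable def canParts (K : CMI n) : Multiset (Finset (Fin n)) :=
  if Multiset.card K.Qs ≤ 1 then 0
  else if repSet K ≠ ∅ ∧ Multiset.card (parts K) ≤ 1 then 0
  else parts K

/-- The canonical form `can(K)` (of a pure-form CMI); all degenerate canonical forms
`(·,⟨⟩)` are represented by `⟨∅, 0⟩`. -/
noncomputable def can (K : CMI n) : CMI n :=
  if Multiset.card K.Qs ≤ 1 then ⟨∅, 0⟩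
  else if repSet K = ∅ then ⟨K.C, parts K⟩
  else if Multiset.card (parts K) ≤ 1 then ⟨K.C, {repSet K, repSet K}⟩
  else ⟨K.C, repSet K ::ₘ repSet K ::ₘ parts K⟩

/-- `R_K^{K'}`: the CMI "`K'` conditioning on `K`"; the degenerate case `(·,⟨⟩)` is
represented by `⟨∅, 0⟩`. -/
noncomputable def RCond (K K' : CMI n) : CMI n :=
  let I := repSet (pur K)
  let I' := repSet (pur K')
  let Ts := ((canParts (pur K')).map fun P => P \ I).filter fun T => T ≠ ∅
  if I' \ I = ∅ ∧ Multiset.card Ts ≤ 1 then ⟨∅, 0⟩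
  else if I' \ I = ∅ then ⟨K'.C \ I, Ts⟩
  else if Multiset.card Ts ≤ 1 then ⟨K'.C \ I, {I' \ I, I' \ I}⟩
  else ⟨K'.C \ I, (I' \ I) ::ₘ (I' \ I) ::ₘ Ts⟩


/-- The probability that `f` takes the same value as it does at `x`. -/
noncomputable def fiberProb {Ω S : Type*} (p : PMF Ω) (f : Ω → S) (x : Ω) : ENNReal :=
  p.map f (f x)

/-- The Shannon entropy of the random variable `f`, as an extended nonnegative real. -/
noncomputable def entropy {Ω S : Type*} (p : PMF Ω) (f : Ω → S) : ENNReal :=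
  ∑' x, p x * ENNReal.ofReal (-Real.log (fiberProb p f x).toReal)

theorem tsum_map_mul {Ω S : Type*} (p : PMF Ω) (f : Ω → S) (φ : S → ENNReal) :
    ∑' y, p.map f y * φ y = ∑' x, p x * φ (f x) := by
  simp_rw [PMF.map_apply, ← ENNReal.tsum_mul_right]
  rw [ENNReal.tsum_comm]
  refine tsum_congr fun x => ?_
  simp_rw [ite_mul, zero_mul]
  exact tsum_ite_eq (f x) _

theorem fiberProb_le_of_imp {Ω S T : Type*} (p : PMF Ω) {f : Ω → S} {g : Ω → T} {x : Ω}
    (h : ∀ a, f x = f a → g x = g a) : fiberProb p f x ≤ fiberProb p g x := by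
  unfold fiberProb
  rw [PMF.map_apply, PMF.map_apply]
  refine ENNReal.tsum_le_tsum fun a => ?_
  by_cases hf : f x = f a
  · simp [hf, ← h a hf]
  · simp [hf]

theorem le_fiberProb {Ω S : Type*} (p : PMF Ω) (f : Ω → S) (x : Ω) :
    p x ≤ fiberProb p f x := by
  unfold fiberProb
  rw [PMF.map_apply]
  refine le_trans (by simp) (ENNReal.le_tsum x)

theorem fiberProb_le_one {Ω S : Type*} (p : PMF Ω) (f : Ω → S) (x : Ω) :
    fiberProb p f x ≤ 1 :=
  PMF.coe_le_one _ _

theorem fiberProb_toReal_pos {Ω S : Type*} {p : PMF Ω} (f : Ω → S) {x : Ω} (hx : p x ≠ 0) :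
    0 < (fiberProb p f x).toReal :=
  ENNReal.toReal_pos ((pos_iff_ne_zero.2 hx).trans_le (le_fiberProb p f x)).ne'
    ((fiberProb_le_one p f x).trans_lt ENNReal.one_lt_top).ne

theorem fiberProb_toReal_le_one {Ω S : Type*} (p : PMF Ω) (f : Ω → S) (x : Ω) :
    (fiberProb p f x).toReal ≤ 1 := by
  simpa using ENNReal.toReal_mono ENNReal.one_ne_top (fiberProb_le_one p f x)

theorem entropy_le_of_imp {Ω S T : Type*} (p : PMF Ω) {f : Ω → S} {g : Ω → T}
    (h : ∀ x a, f x = f a → g x = g a) : entropy p g ≤ entropy p f := by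
  refine ENNReal.tsum_le_tsum fun x => ?_
  by_cases hx : p x = 0
  · simp [hx]
  · gcongr
    · exact fiberProb_toReal_pos f hx
    · exact ((fiberProb_le_one p g x).trans_lt ENNReal.one_lt_top).ne
    · exact fiberProb_le_of_imp p (h x)

theorem tsum_ofReal_negMulLog_map {Ω S : Type*} (p : PMF Ω) (f : Ω → S) :
    ∑' y, ENNReal.ofReal (Real.negMulLog (p.map f y).toReal) = entropy p f := by
  unfold entropy fiberProb
  rw [← tsum_map_mul p f fun y => ENNReal.ofReal (-Real.log (p.map f y).toReal)]
  refine tsum_congr fun y => ?_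
  rw [Real.negMulLog, neg_mul_comm, ENNReal.ofReal_mul ENNReal.toReal_nonneg,
    ENNReal.ofReal_toReal (PMF.apply_ne_top _ _)]

theorem negMulLog_map_nonneg {Ω S : Type*} (p : PMF Ω) (f : Ω → S) (y : S) :
    0 ≤ Real.negMulLog (p.map f y).toReal :=
  Real.negMulLog_nonneg ENNReal.toReal_nonneg
    (by simpa using ENNReal.toReal_mono ENNReal.one_ne_top (PMF.coe_le_one (p.map f) y))

theorem tsum_negMulLog_map {Ω S : Type*} (p : PMF Ω) (f : Ω → S) :
    ∑' y, Real.negMulLog (p.map f y).toReal = (entropy p f).toReal := by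
  rw [← tsum_ofReal_negMulLog_map, ENNReal.tsum_toReal_eq fun _ => ENNReal.ofReal_ne_top]
  exact tsum_congr fun y => (ENNReal.toReal_ofReal (negMulLog_map_nonneg p f y)).symm

/-- The conditionally independent coupling of `f` and `g` given `u ∘ f = v ∘ g` has total
mass at most one on the support of `(f, g)`. -/
theorem tsum_mul_fiberProb_ratio_le_one {Ω S T U : Type*} (p : PMF Ω) (f : Ω → S) (g : Ω → T)
    (u : S → U) (v : T → U) (huv : u ∘ f = v ∘ g) :
    ∑' x, p x * (fiberProb p f x * fiberProb p g x /
      (fiberProb p (u ∘ f) x * fiberProb p (fun a => (f a, g a)) x)) ≤ 1 := by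
  set k : Ω → S × T := fun a => (f a, g a) with hk
  have hfib := tsum_map_mul p k fun y =>
    p.map f y.1 * p.map g y.2 / (p.map (u ∘ f) (u y.1) * p.map k y)
  refine hfib.symm.trans_le ?_
  have hbound : ∀ y : S × T,
      p.map k y * (p.map f y.1 * p.map g y.2 / (p.map (u ∘ f) (u y.1) * p.map k y)) ≤
        p.map f y.1 * ((p.map (u ∘ f) (u y.1))⁻¹ *
          (if u y.1 = v y.2 then p.map g y.2 else 0)) := by
    rintro ⟨s, t⟩
    by_cases h0 : p.map k (s, t) = 0
    · simp [h0]
    · have hmem : (s, t) ∈ (p.map k).support := (PMF.mem_support_iff _ _).2 h0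
      rw [PMF.support_map] at hmem
      obtain ⟨x, -, hx⟩ := hmem
      obtain ⟨rfl, rfl⟩ := Prod.mk.inj hx
      have huvx : u (f x) = v (g x) := congrFun huv x
      have htop := PMF.apply_ne_top (p.map k) (f x, g x)
      rw [if_pos huvx, div_eq_mul_inv, ENNReal.mul_inv (Or.inr htop) (Or.inr h0)]
      calc _ = p.map f (f x) * ((p.map (u ∘ f) (u (f x)))⁻¹ * p.map g (g x)) *
              (p.map k (f x, g x) * (p.map k (f x, g x))⁻¹) := by ring
        _ ≤ _ := by rw [ENNReal.mul_inv_cancel h0 htop, mul_one]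
  refine (ENNReal.tsum_le_tsum hbound).trans ?_
  rw [ENNReal.tsum_prod']
  have hinner : ∀ s, ∑' t, p.map f s * ((p.map (u ∘ f) (u s))⁻¹ *
      (if u s = v t then p.map g t else 0)) ≤ p.map f s := by
    intro s
    rw [ENNReal.tsum_mul_left, ENNReal.tsum_mul_left, ← PMF.map_apply, PMF.map_comp, ← huv]
    calc _ ≤ p.map f s * 1 := by gcongr; exact ENNReal.inv_mul_le_one _
      _ = _ := mul_one _
  exact (ENNReal.tsum_le_tsum hinner).trans (PMF.tsum_coe _).le

theorem ofReal_neg_log_add_le {a b c d : ENNReal} (ha : 0 < a.toReal) (hb : 0 < b.toReal)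
    (hc : 0 < c.toReal) (hd : 0 < d.toReal) (ha1 : a.toReal ≤ 1) (hb1 : b.toReal ≤ 1)
    (hc1 : c.toReal ≤ 1) (hd1 : d.toReal ≤ 1) :
    ENNReal.ofReal (-Real.log d.toReal) + ENNReal.ofReal (-Real.log c.toReal) + 1 ≤
      ENNReal.ofReal (-Real.log a.toReal) + ENNReal.ofReal (-Real.log b.toReal) +
        a * b / (c * d) := by
  have hla := Real.log_nonpos ha.le ha1
  have hlb := Real.log_nonpos hb.le hb1
  have hlc := Real.log_nonpos hc.le hc1
  have hld := Real.log_nonpos hd.le hd1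
  have hratio : a * b / (c * d) =
      ENNReal.ofReal (a.toReal * b.toReal / (c.toReal * d.toReal)) := by
    rw [ENNReal.ofReal_div_of_pos (by positivity), ENNReal.ofReal_mul ha.le,
      ENNReal.ofReal_mul hc.le, ENNReal.ofReal_toReal (ENNReal.toReal_pos_iff.1 ha).2.ne,
      ENNReal.ofReal_toReal (ENNReal.toReal_pos_iff.1 hb).2.ne,
      ENNReal.ofReal_toReal (ENNReal.toReal_pos_iff.1 hc).2.ne,
      ENNReal.ofReal_toReal (ENNReal.toReal_pos_iff.1 hd).2.ne]
  rw [hratio, ← ENNReal.ofReal_one, ← ENNReal.ofReal_add (by linarith) (by linarith),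
    ← ENNReal.ofReal_add (by linarith) zero_le_one,
    ← ENNReal.ofReal_add (by linarith) (by linarith),
    ← ENNReal.ofReal_add (by linarith) (by positivity)]
  apply ENNReal.ofReal_le_ofReal
  have hlog := Real.log_le_sub_one_of_pos
    (show 0 < a.toReal * b.toReal / (c.toReal * d.toReal) by positivity)
  rw [Real.log_div (by positivity) (by positivity), Real.log_mul ha.ne' hb.ne',
    Real.log_mul hc.ne' hd.ne'] at hlog
  linarith

theorem entropy_submodular {Ω S T U : Type*} (p : PMF Ω) (f : Ω → S) (g : Ω → T)
    (u : S → U) (v : T → U) (huv : u ∘ f = v ∘ g) :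
    entropy p (fun a => (f a, g a)) + entropy p (u ∘ f) ≤ entropy p f + entropy p g := by
  rw [← ENNReal.add_le_add_iff_right ENNReal.one_ne_top]
  refine le_trans ?_ (add_le_add_right (tsum_mul_fiberProb_ratio_le_one p f g u v huv) _)
  rw [← PMF.tsum_coe p]
  unfold entropy
  simp_rw [← ENNReal.tsum_add]
  refine ENNReal.tsum_le_tsum fun x => ?_
  by_cases hx : p x = 0
  · simp [hx]
  · have h := ofReal_neg_log_add_le (fiberProb_toReal_pos f hx) (fiberProb_toReal_pos g hx)
      (fiberProb_toReal_pos (u ∘ f) hx) (fiberProb_toReal_pos (fun a => (f a, g a)) hx)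
      (fiberProb_toReal_le_one p f x) (fiberProb_toReal_le_one p g x)
      (fiberProb_toReal_le_one p (u ∘ f) x) (fiberProb_toReal_le_one p (fun a => (f a, g a)) x)
    have h' := mul_le_mul_right h (p x)
    simpa only [mul_add, mul_one] using h'

/-- The tuple `X_α`, as a function of the outcome. -/
def proj (α : Finset (Fin n)) (x : Fin n → ℕ) : { i // i ∈ α } → ℕ := fun i => x i.1

theorem proj_eq_iff {α : Finset (Fin n)} {x a : Fin n → ℕ} :
    proj α x = proj α a ↔ ∀ i ∈ α, x i = a i := by
  simp [proj, funext_iff]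

theorem entropy_proj_mono (p : PMF (Fin n → ℕ)) {α β : Finset (Fin n)} (h : α ⊆ β) :
    entropy p (proj α) ≤ entropy p (proj β) :=
  entropy_le_of_imp p fun _ _ hxa => proj_eq_iff.2 fun i hi => proj_eq_iff.1 hxa i (h hi)

theorem entropy_proj_submodular (p : PMF (Fin n → ℕ)) {A B C : Finset (Fin n)}
    (hA : C ⊆ A) (hB : C ⊆ B) :
    entropy p (proj (A ∪ B)) + entropy p (proj C) ≤
      entropy p (proj A) + entropy p (proj B) := by
  refine le_trans (add_le_add_left (entropy_le_of_imp p fun x a hxa => ?_) _)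
    (entropy_submodular p (proj A) (proj B) (fun y (i : { i // i ∈ C }) => y ⟨i.1, hA i.2⟩)
      (fun y i => y ⟨i.1, hB i.2⟩) rfl)
  obtain ⟨h1, h2⟩ := Prod.mk.inj hxa
  rw [proj_eq_iff] at h1 h2 ⊢
  intro i hi
  exact (Finset.mem_union.1 hi).elim (h1 i) (h2 i)

theorem FiniteEntropy.entropy_proj_ne_top {p : PMF (Fin n → ℕ)} (hp : FiniteEntropy p)
    (α : Finset (Fin n)) : entropy p (proj α) ≠ ⊤ := by
  induction α using Finset.induction_on with
  | empty =>
    have h1 : ∀ x, fiberProb p (proj (∅ : Finset (Fin n))) x = 1 := fun x => by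
      unfold fiberProb
      rw [PMF.map_apply, ← PMF.tsum_coe p]
      exact tsum_congr fun a => if_pos (proj_eq_iff.2 (by simp))
    simp [entropy, h1]
  | insert i s _ ih =>
    have hi : entropy p (proj {i}) ≠ ⊤ := by
      have hsum := (hp i).tsum_ofReal_ne_top
      rw [tsum_ofReal_negMulLog_map] at hsum
      refine ne_top_of_le_ne_top hsum (entropy_le_of_imp p fun x a hxa => ?_)
      rw [proj_eq_iff]
      simpa using hxa
    refine ne_top_of_le_ne_top (ENNReal.add_ne_top.2 ⟨hi, ih⟩)
      (le_trans ?_ (entropy_proj_submodular p (Finset.empty_subset {i}) (Finset.empty_subset s)))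
    exact le_self_add

theorem Hm_eq_toReal_entropy (p : PMF (Fin n → ℕ)) (α : Finset (Fin n)) :
    Hm p α = (entropy p (proj α)).toReal :=
  tsum_negMulLog_map p (proj α)

theorem FiniteEntropy.Hm_mono {p : PMF (Fin n → ℕ)} (hp : FiniteEntropy p)
    {α β : Finset (Fin n)} (h : α ⊆ β) : Hm p α ≤ Hm p β := by
  rw [Hm_eq_toReal_entropy, Hm_eq_toReal_entropy]
  exact ENNReal.toReal_mono (hp.entropy_proj_ne_top β) (entropy_proj_mono p h)

theorem FiniteEntropy.Hm_submodular {p : PMF (Fin n → ℕ)} (hp : FiniteEntropy p)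
    {A B C : Finset (Fin n)} (hA : C ⊆ A) (hB : C ⊆ B) :
    Hm p (A ∪ B) + Hm p C ≤ Hm p A + Hm p B := by
  simp only [Hm_eq_toReal_entropy]
  have hne := hp.entropy_proj_ne_top
  rw [← ENNReal.toReal_add (hne _) (hne _), ← ENNReal.toReal_add (hne _) (hne _)]
  exact ENNReal.toReal_mono (ENNReal.add_ne_top.2 ⟨hne _, hne _⟩)
    (entropy_proj_submodular p hA hB)

theorem FiniteEntropy.Hc_union_add_le {p : PMF (Fin n → ℕ)} (hp : FiniteEntropy p)
    {A B D : Finset (Fin n)} (C : Finset (Fin n)) (hA : D ⊆ A) (hB : D ⊆ B) :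
    Hc p (A ∪ B) C + Hc p D C ≤ Hc p A C + Hc p B C := by
  have h := hp.Hm_submodular (Finset.union_subset_union_left (t := C) hA)
    (Finset.union_subset_union_left (t := C) hB)
  rw [← Finset.union_union_distrib_right] at h
  unfold Hc
  linarith

theorem FiniteEntropy.Hc_nonneg {p : PMF (Fin n → ℕ)} (hp : FiniteEntropy p)
    (B C : Finset (Fin n)) : 0 ≤ Hc p B C :=
  sub_nonneg.2 (hp.Hm_mono Finset.subset_union_right)

theorem FiniteEntropy.Hc_union_le {p : PMF (Fin n → ℕ)} (hp : FiniteEntropy p)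
    (A B C : Finset (Fin n)) : Hc p (A ∪ B) C ≤ Hc p A C + Hc p B C := by
  have h := hp.Hc_union_add_le C (Finset.empty_subset A) (Finset.empty_subset B)
  have h0 := hp.Hc_nonneg ∅ C
  linarith

theorem FiniteEntropy.Hc_sup_le_sum {p : PMF (Fin n → ℕ)} (hp : FiniteEntropy p)
    (C : Finset (Fin n)) (Qs : Multiset (Finset (Fin n))) :
    Hc p Qs.sup C ≤ (Qs.map fun Q => Hc p Q C).sum := by
  induction Qs using Multiset.induction_on with
  | empty => simp [Hc]
  | cons Q s ih =>
    have h := hp.Hc_union_le Q s.sup C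
    rw [Multiset.sup_cons, Multiset.map_cons, Multiset.sum_cons, Finset.sup_eq_union]
    linarith

/-- if a pure-form CMI with `k ≥ 2` is valid, then `H(X_q|X_C) = 0`
for every repeated index `q` (one lying in `Q_i ∩ Q_j` for two distinct entries). -/
theorem stmt2 {n : ℕ} (K : CMI n) (hpure : IsPure K)
    (hk : 2 ≤ Multiset.card K.Qs)
    (p : PMF (Fin n → ℕ)) (hp : FiniteEntropy p) (hval : Valid p K)
    (q : Fin n) (Q Q' : Finset (Fin n)) (hQ : Q ∈ K.Qs) (hQ' : Q' ∈ K.Qs.erase Q)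
    (hq : q ∈ Q) (hq' : q ∈ Q') :
    Hc p {q} K.C = 0 := by
  obtain ⟨s, hs⟩ := Multiset.exists_cons_of_mem hQ'
  have hQs : K.Qs = Q ::ₘ Q' ::ₘ s := by rw [← hs, Multiset.cons_erase hQ]
  have hJ : J p K.C K.Qs = 0 := hval
  rw [J, hQs] at hJ
  simp only [Multiset.map_cons, Multiset.sum_cons, Multiset.sup_cons, Finset.sup_eq_union,
    ← Finset.union_assoc] at hJ
  have hrest := hp.Hc_sup_le_sum K.C s
  have hunion := hp.Hc_union_le (Q ∪ Q') s.sup K.C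
  have hsub := hp.Hc_union_add_le K.C (Finset.singleton_subset_iff.2 hq)
    (Finset.singleton_subset_iff.2 hq')
  have hnonneg := hp.Hc_nonneg {q} K.C
  linarith

end Paper
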